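/- Let W : ℝ → ℝ satisfy W(x) * exp(W(x)) = x and W(x) > 0 for all x > 0. Then for all x > 0, W(x)/x = (2/π) * ∫ from 0 to π/2 of ((v^2 + (1 + v*tan v)^2) * v * sec(v) * exp(v*tan v) * tan(v)) / (x^2 + v^2 * sec(v)^2 * exp(2*v*tan v)) dv. -/

import Mathlib

open Real

open Set Filter Topology

/-- The closed region to the right of the curve `v ↦ v * tan v + i * v`, `|v| < π / 2`, which
`w ↦ w * exp w` maps onto the closed right half-plane. -/
def lambertRegion : Set ℂ :=
  {w | w.im ∈ Ioo (-(π / 2)) (π / 2) ∧ w.im * tan w.im ≤ w.re}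

lemma mul_tan_nonneg {v : ℝ} (hv : v ∈ Ioo (-(π / 2)) (π / 2)) : 0 ≤ v * tan v := by
  rcases le_total 0 v with h | h
  · exact mul_nonneg h (tan_nonneg_of_nonneg_of_le_pi_div_two h hv.2.le)
  · exact mul_nonneg_of_nonpos_of_nonpos h (tan_nonpos_of_nonpos_of_neg_pi_div_two_le h hv.1.le)

lemma hasDerivAt_mul_tan {v : ℝ} (hv : v ∈ Ioo (-(π / 2)) (π / 2)) :
    HasDerivAt (fun t => t * tan t) (tan v + v / cos v ^ 2) v := by
  refine ((hasDerivAt_id v).mul (hasDerivAt_tan (cos_pos_of_mem_Ioo hv).ne')).congr_deriv ?_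
  simp [div_eq_mul_inv]

lemma convexOn_mul_tan : ConvexOn ℝ (Ioo (-(π / 2)) (π / 2)) fun v => v * tan v := by
  have hd2 : ∀ v ∈ Ioo (-(π / 2)) (π / 2), HasDerivAt (fun t => tan t + t / cos t ^ 2)
      (2 * (1 + v * tan v) / cos v ^ 2) v := by
    intro v hv
    have hc := (cos_pos_of_mem_Ioo hv).ne'
    refine ((hasDerivAt_tan hc).add
      ((hasDerivAt_id v).div ((hasDerivAt_cos v).pow 2) (pow_ne_zero 2 hc))).congr_deriv ?_
    simp only [tan_eq_sin_div_cos, id, Pi.pow_apply]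
    field_simp
    norm_num
    ring
  apply convexOn_of_hasDerivWithinAt2_nonneg (convex_Ioo _ _)
    (fun v hv => (hasDerivAt_mul_tan hv).continuousAt.continuousWithinAt)
    (f' := fun v => tan v + v / cos v ^ 2) (f'' := fun v => 2 * (1 + v * tan v) / cos v ^ 2)
  all_goals rw [interior_Ioo]; intro v hv
  · exact (hasDerivAt_mul_tan hv).hasDerivWithinAt
  · exact (hd2 v hv).hasDerivWithinAt
  · have := mul_tan_nonneg hv
    positivity

lemma convex_lambertRegion : Convex ℝ lambertRegion := by
  intro w hw z hz a b ha hb hab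
  have h := convexOn_mul_tan
  refine ⟨?_, ?_⟩
  · have := h.1 hw.1 hz.1 ha hb hab
    simpa using this
  · have := h.2 hw.1 hz.1 ha hb hab
    have h1 := mul_le_mul_of_nonneg_left hw.2 ha
    have h2 := mul_le_mul_of_nonneg_left hz.2 hb
    simp only [smul_eq_mul] at this
    simp only [Complex.add_im, Complex.add_re, Complex.smul_re, Complex.smul_im, smul_eq_mul]
    linarith

lemma eq_ofReal_of_mem_lambertRegion {w : ℂ} {a : ℝ} (hw : w ∈ lambertRegion) (ha : 0 < a)
    (h : (w * Complex.exp w) ^ 2 = ((a * exp a : ℝ) : ℂ) ^ 2) : w = a := by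
  obtain ⟨hv, hu⟩ := hw
  have hg := mul_tan_nonneg hv
  have hc := cos_pos_of_mem_Ioo hv
  have hz : ∃ r : ℝ, w * Complex.exp w = r ∧ |r| = a * exp a := by
    rcases sq_eq_sq_iff_eq_or_eq_neg.1 h with h | h
    · exact ⟨_, h, abs_of_pos (by positivity)⟩
    · exact ⟨-(a * exp a), by rw [h]; push_cast; rfl, by
        rw [abs_neg]; exact abs_of_pos (by positivity)⟩
  obtain ⟨r, hr, hra⟩ := hz
  have him := congrArg Complex.im hr
  rw [Complex.mul_im, Complex.exp_re, Complex.exp_im, Complex.ofReal_im] at him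
  have him2 : w.re * sin w.im + w.im * cos w.im = 0 := by
    have : exp w.re * (w.re * sin w.im + w.im * cos w.im) = 0 := by linarith
    exact (mul_eq_zero.1 this).resolve_left (exp_ne_zero _)
  have hs : 0 ≤ w.im * sin w.im := by
    rw [tan_eq_sin_div_cos, mul_div_assoc', le_div_iff₀ hc] at hg
    linarith
  have hv0 : w.im = 0 := by
    have h1 : w.re * (w.im * sin w.im) + w.im ^ 2 * cos w.im = 0 := by
      linear_combination w.im * him2
    have h2 := mul_nonneg (hg.trans hu) hs
    have h3 : w.im ^ 2 * cos w.im = 0 :=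
      le_antisymm (by linarith) (by positivity)
    simpa [hc.ne'] using h3
  have hre : w.re * exp w.re = a * exp a := by
    have h1 := congrArg Complex.re hr
    rw [Complex.mul_re, Complex.exp_re, Complex.exp_im, Complex.ofReal_re, hv0] at h1
    simp only [cos_zero, mul_one, zero_mul, sub_zero] at h1
    rw [← hra, ← h1, abs_of_nonneg (mul_nonneg (hg.trans hu) (exp_pos _).le)]
  have hwa : w.re = a := by
    rcases lt_trichotomy w.re a with hlt | heq | hlt
    · have := mul_lt_mul hlt (exp_lt_exp.2 hlt).le (exp_pos _) ha.le
      linarith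
    · exact heq
    · have := mul_lt_mul hlt (exp_lt_exp.2 hlt).le (exp_pos _) (hg.trans hu)
      linarith
  exact Complex.ext (by simpa using hwa) (by simpa using hv0)

lemma lambertRegion_mem_nhds {a : ℝ} (ha : 0 < a) : lambertRegion ∈ 𝓝 (a : ℂ) := by
  have h0 : (0 : ℝ) ∈ Ioo (-(π / 2)) (π / 2) := by constructor <;> linarith [pi_pos]
  have h1 : ∀ᶠ w in 𝓝 (a : ℂ), w.im ∈ Ioo (-(π / 2)) (π / 2) :=
    Complex.continuous_im.continuousAt.eventually_mem (isOpen_Ioo.mem_nhds (by simpa using h0))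
  have h2 : ∀ᶠ w in 𝓝 (a : ℂ), w.im * tan w.im < w.re := by
    refine ContinuousAt.eventually_lt ?_ Complex.continuous_re.continuousAt (by simpa using ha)
    exact ContinuousAt.comp (f := Complex.im) (g := fun t => t * tan t)
      (by simpa using (hasDerivAt_mul_tan h0).continuousAt) Complex.continuous_im.continuousAt
  filter_upwards [h1, h2] with w hw1 hw2 using ⟨hw1, hw2.le⟩

/-- The pull-back of `W(z) dz / (z ^ 2 - x ^ 2)` along `z = w * exp w`, where `x = a * exp a`. -/
noncomputable def lambertKernel (a : ℝ) (w : ℂ) : ℂ :=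
  w * ((1 + w) * Complex.exp w) / ((w * Complex.exp w) ^ 2 - ((a * exp a : ℝ) : ℂ) ^ 2)

/-- Subtracting its simple pole at `a` makes `lambertKernel a` holomorphic on `lambertRegion`. -/
lemma exists_regular_part {a : ℝ} (ha : 0 < a) :
    ∃ h : ℂ → ℂ, DifferentiableOn ℂ h lambertRegion ∧ ∀ w ∈ lambertRegion, w ≠ a →
      h w = lambertKernel a w - ((exp (-a) / 2 : ℝ) : ℂ) / (w - a) := by
  set p : ℂ → ℂ := fun w => (w * Complex.exp w) ^ 2 - ((a * exp a : ℝ) : ℂ) ^ 2 with hp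
  have hpa : p a = 0 := by simp [hp]
  have hpd : HasDerivAt p (2 * (a * Complex.exp a) * ((1 + a) * Complex.exp a)) (a : ℂ) := by
    have h1 : HasDerivAt (fun w : ℂ => w * Complex.exp w) ((1 + a) * Complex.exp a) (a : ℂ) := by
      refine ((hasDerivAt_id (a : ℂ)).mul (Complex.hasDerivAt_exp a)).congr_deriv ?_
      simp only [id]
      ring
    refine ((h1.pow 2).sub_const (((a * exp a : ℝ) : ℂ) ^ 2)).congr_deriv ?_
    simp
  have ha0 : (a : ℂ) ≠ 0 := by exact_mod_cast ha.ne'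
  have ha1 : (1 + a : ℂ) ≠ 0 := by exact_mod_cast (by positivity : (1 + a : ℝ) ≠ 0)
  have hq : Differentiable ℂ (dslope p a) := by
    rw [← differentiableOn_univ, Complex.differentiableOn_dslope univ_mem]
    fun_prop
  have hqne : ∀ w ∈ lambertRegion, dslope p a w ≠ 0 := by
    intro w hw
    rcases eq_or_ne w a with rfl | hne
    · rw [dslope_same, hpd.deriv]
      simp [ha0, ha1, Complex.exp_ne_zero]
    · rw [dslope_of_ne _ hne, slope_def_field, hpa, sub_zero]
      refine div_ne_zero (fun h0 => hne ?_) (sub_ne_zero.2 hne)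
      exact eq_ofReal_of_mem_lambertRegion hw ha (sub_eq_zero.1 h0)
  set G : ℂ → ℂ := fun w => w * ((1 + w) * Complex.exp w) / dslope p a w with hG
  have hGd : DifferentiableOn ℂ G lambertRegion :=
    DifferentiableOn.div (by fun_prop) hq.differentiableOn hqne
  refine ⟨dslope G a, (Complex.differentiableOn_dslope (lambertRegion_mem_nhds ha)).2 hGd, ?_⟩
  intro w hw hne
  have hGa : G a = ((exp (-a) / 2 : ℝ) : ℂ) := by
    simp only [hG, dslope_same, hpd.deriv]
    push_cast
    rw [Complex.exp_neg]
    field_simp [Complex.exp_ne_zero]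
  have hpw : p w ≠ 0 := fun h0 =>
    hne (eq_ofReal_of_mem_lambertRegion hw ha (sub_eq_zero.1 h0))
  have hwa : w - a ≠ 0 := sub_ne_zero.2 hne
  rw [dslope_of_ne _ hne, slope_def_field, hGa, sub_div]
  simp only [hG, lambertKernel, dslope_of_ne _ hne, slope_def_field, hpa, sub_zero]
  change _ = _ / p w - _
  field_simp

/-- The boundary curve of `lambertRegion`, mapped by `w ↦ w * exp w` to the imaginary axis. -/
noncomputable def lambertCurve (v : ℝ) : ℂ := ((v * tan v : ℝ) : ℂ) + v * Complex.I

@[simp]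
lemma lambertCurve_re (v : ℝ) : (lambertCurve v).re = v * tan v := by
  simp [lambertCurve, -Complex.ofReal_mul]

@[simp]
lemma lambertCurve_im (v : ℝ) : (lambertCurve v).im = v := by
  simp [lambertCurve, -Complex.ofReal_mul]

lemma lambertCurve_mem {v : ℝ} (hv : v ∈ Ioo (-(π / 2)) (π / 2)) :
    lambertCurve v ∈ lambertRegion := by
  simpa [lambertRegion] using hv

lemma lambertCurve_neg (v : ℝ) :
    lambertCurve (-v) = (starRingEnd ℂ) (lambertCurve v) :=
  Complex.ext (by simp) (by simp)

lemma hasDerivAt_lambertCurve {v : ℝ} (hv : v ∈ Ioo (-(π / 2)) (π / 2)) :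
    HasDerivAt lambertCurve (((tan v + v / cos v ^ 2 : ℝ) : ℂ) + Complex.I) v := by
  refine ((hasDerivAt_mul_tan hv).ofReal_comp.add
    ((hasDerivAt_id v).ofReal_comp.mul_const Complex.I)).congr_deriv ?_
  simp

lemma exp_lambertCurve (v : ℝ) :
    Complex.exp (lambertCurve v) = exp (v * tan v) * (cos v + sin v * Complex.I) := by
  rw [lambertCurve, Complex.exp_add, Complex.exp_mul_I]
  push_cast
  rfl

lemma lambertCurve_mul_exp {v : ℝ} (hv : v ∈ Ioo (-(π / 2)) (π / 2)) :
    lambertCurve v * Complex.exp (lambertCurve v) =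
      ((v * (1 / cos v) * exp (v * tan v) : ℝ) : ℂ) * Complex.I := by
  have hc := (cos_pos_of_mem_Ioo hv).ne'
  have hsc := sin_sq_add_cos_sq v
  rw [exp_lambertCurve, lambertCurve, tan_eq_sin_div_cos]
  apply Complex.ext
  · simp [-Complex.ofReal_mul, -Complex.ofReal_div, -Complex.ofReal_exp, -Complex.ofReal_cos,
      -Complex.ofReal_sin]
    field_simp
    ring
  · simp [-Complex.ofReal_mul, -Complex.ofReal_div, -Complex.ofReal_exp, -Complex.ofReal_cos,
      -Complex.ofReal_sin]
    field_simp
    linear_combination v * hsc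

lemma deriv_lambertCurve_mul_exp {v : ℝ} (hv : v ∈ Ioo (-(π / 2)) (π / 2)) :
    (1 + lambertCurve v) * Complex.exp (lambertCurve v) *
        (((tan v + v / cos v ^ 2 : ℝ) : ℂ) + Complex.I) =
      (((v ^ 2 + (1 + v * tan v) ^ 2) * (1 / cos v) * exp (v * tan v) : ℝ) : ℂ) * Complex.I := by
  have hc := (cos_pos_of_mem_Ioo hv).ne'
  have hsc : sin v ^ 2 = 1 - cos v ^ 2 := by linarith [sin_sq_add_cos_sq v]
  rw [exp_lambertCurve, lambertCurve]
  generalize hE : exp (v * tan v) = E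
  rw [tan_eq_sin_div_cos]
  apply Complex.ext
  · simp [-Complex.ofReal_mul, -Complex.ofReal_div, -Complex.ofReal_exp, -Complex.ofReal_cos,
      -Complex.ofReal_sin, -Complex.ofReal_add, -Complex.ofReal_pow]
    field_simp
    linear_combination (-E * cos v * v) * hsc
  · simp [-Complex.ofReal_mul, -Complex.ofReal_div, -Complex.ofReal_exp, -Complex.ofReal_cos,
      -Complex.ofReal_sin, -Complex.ofReal_add, -Complex.ofReal_pow]
    field_simp
    linear_combination E * (cos v ^ 2 + v * sin v * cos v) * hsc

/-- The integrand of the Cauer representation. -/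
noncomputable def cauerIntegrand (x v : ℝ) : ℝ :=
  ((v ^ 2 + (1 + v * tan v) ^ 2) * v * (1 / cos v) * exp (v * tan v) * tan v) /
    (x ^ 2 + v ^ 2 * (1 / cos v) ^ 2 * exp (2 * v * tan v))

lemma cauerIntegrand_neg (x v : ℝ) : cauerIntegrand x (-v) = cauerIntegrand x v := by
  simp [cauerIntegrand]

lemma cauerIntegrand_nonneg (x : ℝ) {v : ℝ} (hv : v ∈ Ioo 0 (π / 2)) :
    0 ≤ cauerIntegrand x v := by
  have h0 := hv.1
  have ht := tan_pos_of_pos_of_lt_pi_div_two hv.1 hv.2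
  have hc := cos_pos_of_mem_Ioo ⟨by linarith [pi_pos], hv.2⟩
  unfold cauerIntegrand
  positivity

lemma im_lambertKernel_lambertCurve (a : ℝ) {v : ℝ} (hv : v ∈ Ioo (-(π / 2)) (π / 2)) :
    (lambertKernel a (lambertCurve v) * (((tan v + v / cos v ^ 2 : ℝ) : ℂ) + Complex.I)).im =
      -cauerIntegrand (a * exp a) v := by
  rw [lambertKernel, div_mul_eq_mul_div, mul_assoc, deriv_lambertCurve_mul_exp hv,
    lambertCurve_mul_exp hv, lambertCurve, cauerIntegrand,
    show 2 * v * tan v = v * tan v + v * tan v by ring, exp_add]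
  have hden : (((v * (1 / cos v) * exp (v * tan v) : ℝ) : ℂ) * Complex.I) ^ 2 -
      ((a * exp a : ℝ) : ℂ) ^ 2 = ((-((a * exp a) ^ 2 +
        v ^ 2 * (1 / cos v) ^ 2 * (exp (v * tan v) * exp (v * tan v))) : ℝ) : ℂ) := by
    rw [mul_pow, Complex.I_sq]
    push_cast
    ring
  rw [hden, Complex.div_ofReal_im, div_neg]
  congr 2
  rw [Complex.mul_im, Complex.mul_I_re, Complex.mul_I_im, Complex.ofReal_im, Complex.ofReal_re]
  simp [-Complex.ofReal_mul]
  ring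

lemma norm_lambertKernel_le {a : ℝ} (ha : 0 < a) {w : ℂ} (h1 : 1 ≤ w.re)
    (h2 : 2 * (a * exp a) ≤ w.re) : ‖lambertKernel a w‖ ≤ 4 * exp (-w.re) := by
  have hw : w.re ≤ ‖w‖ := Complex.re_le_norm w
  have hE : 1 ≤ exp w.re := one_le_exp (by linarith)
  have hz : ‖w * Complex.exp w‖ = ‖w‖ * exp w.re := by rw [norm_mul, Complex.norm_exp]
  have hx : 0 < a * exp a := by positivity
  have hzx : 2 * (a * exp a) ≤ ‖w‖ * exp w.re := by nlinarith
  have hden : (‖w‖ * exp w.re) ^ 2 / 2 ≤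
      ‖(w * Complex.exp w) ^ 2 - ((a * exp a : ℝ) : ℂ) ^ 2‖ := by
    have h := norm_sub_norm_le ((w * Complex.exp w) ^ 2) (((a * exp a : ℝ) : ℂ) ^ 2)
    rw [norm_pow, norm_pow, hz, Complex.norm_real, norm_of_nonneg hx.le] at h
    nlinarith
  have hnum : ‖w * ((1 + w) * Complex.exp w)‖ ≤ 2 * ‖w‖ ^ 2 * exp w.re := by
    rw [norm_mul, norm_mul, Complex.norm_exp]
    have h : ‖1 + w‖ ≤ 2 * ‖w‖ := (norm_add_le _ _).trans (by rw [norm_one]; linarith)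
    have := mul_le_mul_of_nonneg_left h (by positivity : 0 ≤ ‖w‖ * exp w.re)
    linarith
  have hwpos : 0 < ‖w‖ := by linarith
  rw [lambertKernel, norm_div]
  calc _ ≤ 2 * ‖w‖ ^ 2 * exp w.re / ((‖w‖ * exp w.re) ^ 2 / 2) := by gcongr
    _ = 4 * exp (-w.re) := by
      rw [exp_neg]
      field_simp
      norm_num

lemma tendsto_mul_tan : Tendsto (fun v => v * tan v) (𝓝[<] (π / 2)) atTop :=
  Tendsto.pos_mul_atTop (by positivity) (tendsto_id.mono_left nhdsWithin_le_nhds)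
    tendsto_tan_pi_div_two

lemma tendsto_arg_sub_lambertCurve (a : ℝ) :
    Tendsto (fun v => (↑a - lambertCurve v).arg) (𝓝[<] (π / 2)) (𝓝 (-π)) := by
  have hv0 : ∀ᶠ v in 𝓝[<] (π / 2), v ∈ Ioo 0 (π / 2) :=
    Ioo_mem_nhdsLT (by positivity)
  have hnorm : Tendsto (fun v => ‖(a : ℂ) - lambertCurve v‖) (𝓝[<] (π / 2)) atTop := by
    refine tendsto_atTop_mono (fun v => ?_) (tendsto_atTop_add_const_right _ (-a) tendsto_mul_tan)
    have := (neg_le_abs _).trans (Complex.abs_re_le_norm ((a : ℂ) - lambertCurve v))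
    simp only [Complex.sub_re, Complex.ofReal_re, lambertCurve_re] at this
    linarith
  have hv : Tendsto (fun v : ℝ => v) (𝓝[<] (π / 2)) (𝓝 (π / 2)) :=
    tendsto_id.mono_left nhdsWithin_le_nhds
  have h := (continuous_arcsin.tendsto 0).comp (hv.div_atTop hnorm)
  have h' := h.sub_const π
  rw [arcsin_zero, zero_sub] at h'
  refine h'.congr' ?_
  filter_upwards [hv0, tendsto_mul_tan.eventually_gt_atTop a] with v hv hva
  rw [Complex.arg_of_re_neg_of_im_neg (by simpa using hva) (by simpa using hv.1)]
  simp

lemma sub_lambertCurve_mem_slitPlane {a : ℝ} (ha : 0 < a) (v : ℝ) :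
    (a : ℂ) - lambertCurve v ∈ Complex.slitPlane := by
  rcases eq_or_ne v 0 with rfl | h
  · left; simpa using ha
  · right; simpa using h

lemma tendsto_primitive_sub {a : ℝ} (ha : 0 < a) {h H : ℂ → ℂ}
    (hh : ∀ w ∈ lambertRegion, w ≠ a →
      h w = lambertKernel a w - ((exp (-a) / 2 : ℝ) : ℂ) / (w - a))
    (hH : ∀ w ∈ lambertRegion, HasDerivWithinAt H (h w) lambertRegion w) :
    Tendsto (fun v => H (lambertCurve v) - H (lambertCurve (-v))) (𝓝[<] (π / 2)) (𝓝 0) := by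
  have hlim : Tendsto (fun u : ℝ => (4 * exp (-u) + (exp (-a) / 2) / (u - a)) * 4) atTop
      (𝓝 ((4 * 0 + 0) * 4)) := by
    refine (((tendsto_exp_neg_atTop_nhds_zero).const_mul 4).add ?_).mul_const 4
    exact tendsto_const_nhds.div_atTop (tendsto_atTop_add_const_right _ (-a) tendsto_id)
  norm_num at hlim
  refine squeeze_zero_norm' ?_ (hlim.comp tendsto_mul_tan)
  filter_upwards [Ioo_mem_nhdsLT (by positivity : 0 < π / 2),
    tendsto_mul_tan.eventually_gt_atTop a, tendsto_mul_tan.eventually_ge_atTop 1,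
    tendsto_mul_tan.eventually_ge_atTop (2 * (a * exp a))] with v hv hva hv1 hv2
  set u := v * tan v with hu
  have hvm : v ∈ Ioo (-(π / 2)) (π / 2) := ⟨by linarith [hv.1, pi_pos], hv.2⟩
  have hvm' : -v ∈ Ioo (-(π / 2)) (π / 2) := ⟨by linarith [hv.2], by linarith [hv.1, pi_pos]⟩
  have hconv : Convex ℝ (lambertRegion ∩ {w | w.re = u}) :=
    convex_lambertRegion.inter ((convex_singleton u).linear_preimage Complex.reLm)
  have hbound : ∀ w ∈ lambertRegion ∩ {w | w.re = u},
      ‖h w‖ ≤ 4 * exp (-u) + (exp (-a) / 2) / (u - a) := by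
    rintro w ⟨hw, hwu⟩
    rw [mem_ofPred_eq] at hwu
    have hne : w ≠ a := fun h => by
      rw [h, Complex.ofReal_re] at hwu
      linarith
    rw [hh w hw hne]
    refine (norm_sub_le _ _).trans (add_le_add ?_ ?_)
    · rw [← hwu]
      exact norm_lambertKernel_le ha (hwu ▸ hv1) (hwu ▸ hv2)
    · rw [norm_div, Complex.norm_real, norm_of_nonneg (by positivity)]
      have := Complex.re_le_norm (w - a)
      rw [Complex.sub_re, Complex.ofReal_re, hwu] at this
      have hpos : 0 < u - a := by linarith
      gcongr
  have key := hconv.norm_image_sub_le_of_norm_hasDerivWithin_le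
    (fun w hw => (hH w hw.1).mono inter_subset_left) hbound
    (x := lambertCurve (-v)) (y := lambertCurve v)
    ⟨lambertCurve_mem hvm', by simp [hu]⟩ ⟨lambertCurve_mem hvm, by simp [hu]⟩
  refine key.trans (mul_le_mul_of_nonneg_left ?_ ((norm_nonneg _).trans
    (hbound _ ⟨lambertCurve_mem hvm, by simp [hu]⟩)))
  have hdiff : lambertCurve v - lambertCurve (-v) = ((2 * v : ℝ) : ℂ) * Complex.I :=
    Complex.ext (by simp [-Complex.ofReal_mul]) (by simp [-Complex.ofReal_mul]; ring)
  rw [hdiff, norm_mul, Complex.norm_I, mul_one, Complex.norm_real,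
    norm_of_nonneg (by linarith [hv.1])]
  linarith [hv.2, pi_le_four]

lemma hasDerivAt_im_primitive {a : ℝ} (ha : 0 < a) {h H : ℂ → ℂ}
    (hh : ∀ w ∈ lambertRegion, w ≠ a →
      h w = lambertKernel a w - ((exp (-a) / 2 : ℝ) : ℂ) / (w - a))
    (hH : ∀ w ∈ lambertRegion, HasDerivWithinAt H (h w) lambertRegion w)
    {v : ℝ} (hv : v ∈ Ioo (-(π / 2)) (π / 2)) :
    HasDerivAt (fun t => (H (lambertCurve t) +
        ((exp (-a) / 2 : ℝ) : ℂ) * Complex.log (a - lambertCurve t)).im)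
      (-cauerIntegrand (a * exp a) v) v := by
  have hγ := hasDerivAt_lambertCurve hv
  have hslit := sub_lambertCurve_mem_slitPlane ha v
  have hne0 : (a : ℂ) - lambertCurve v ≠ 0 := Complex.slitPlane_ne_zero hslit
  have hne : lambertCurve v ≠ a := fun h => hne0 (by rw [h, sub_self])
  have h1 : HasDerivAt (fun t => H (lambertCurve t)) _ v :=
    ((hH _ (lambertCurve_mem hv)).scomp v hγ.hasDerivWithinAt
      (fun t ht => lambertCurve_mem ht)).hasDerivAt (isOpen_Ioo.mem_nhds hv)
  have h2 := ((hγ.const_sub (a : ℂ)).clog_real hslit).const_mul ((exp (-a) / 2 : ℝ) : ℂ)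
  have h3 := Complex.imCLM.hasFDerivAt.comp_hasDerivAt v (h1.add h2)
  refine h3.congr_deriv ?_
  rw [← im_lambertKernel_lambertCurve a hv, hh _ (lambertCurve_mem hv) hne, Complex.imCLM_apply]
  congr 1
  have hne1 : lambertCurve v - a ≠ 0 := sub_ne_zero.2 hne
  rw [smul_eq_mul, ← neg_sub (lambertCurve v) (a : ℂ), neg_div_neg_eq]
  ring

lemma integral_cauerIntegrand {a : ℝ} (ha : 0 < a) :
    ∫ v in (0 : ℝ)..(π / 2), cauerIntegrand (a * exp a) v = π / 2 * exp (-a) := by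
  obtain ⟨h, hd, hh⟩ := exists_regular_part ha
  obtain ⟨H, hH⟩ := convex_lambertRegion.exists_forall_hasDerivWithinAt hd
  set Φ : ℝ → ℝ := fun t => (H (lambertCurve t) +
    ((exp (-a) / 2 : ℝ) : ℂ) * Complex.log (a - lambertCurve t)).im with hΦ
  have hΦd : ∀ v ∈ Ioo (-(π / 2)) (π / 2),
      HasDerivAt Φ (-cauerIntegrand (a * exp a) v) v := fun v hv =>
    hasDerivAt_im_primitive ha hh hH hv
  set F : ℝ → ℝ := fun t => (Φ (-t) - Φ t) / 2 with hF
  have hFd : ∀ v ∈ Ioo (-(π / 2)) (π / 2), HasDerivAt F (cauerIntegrand (a * exp a) v) v := by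
    intro v hv
    have hv' : -v ∈ Ioo (-(π / 2)) (π / 2) := ⟨by linarith [hv.2], by linarith [hv.1]⟩
    have h1 : HasDerivAt (fun t => Φ (-t)) _ v := (hΦd (-v) hv').scomp v (hasDerivAt_neg v)
    refine ((h1.sub (hΦd v hv)).div_const 2).congr_deriv ?_
    rw [cauerIntegrand_neg, smul_eq_mul]
    ring
  have hpos : 0 < π / 2 := by positivity
  have hF0 : Tendsto F (𝓝[>] 0) (𝓝 0) := by
    have h0 := (hFd 0 ⟨by linarith, hpos⟩).continuousAt.tendsto
    rw [show F 0 = 0 by simp [hF]] at h0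
    exact h0.mono_left nhdsWithin_le_nhds
  have hF1 : Tendsto F (𝓝[<] (π / 2)) (𝓝 (π / 2 * exp (-a))) := by
    have h1 := (Complex.continuous_im.tendsto 0).comp (tendsto_primitive_sub ha hh hH)
    have h2 := (tendsto_arg_sub_lambertCurve a).const_mul (exp (-a))
    have h3 := ((h1.add h2).neg).div_const 2
    rw [Complex.zero_im, show -(0 + exp (-a) * -π) / 2 = π / 2 * exp (-a) by ring] at h3
    refine h3.congr fun v => ?_
    have harg : ((a : ℂ) - lambertCurve (-v)).arg = -((a : ℂ) - lambertCurve v).arg := by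
      rw [lambertCurve_neg, ← Complex.conj_ofReal, ← map_sub, Complex.arg_conj, Complex.conj_ofReal,
        if_neg (Complex.slitPlane_arg_ne_pi (sub_lambertCurve_mem_slitPlane ha v))]
    simp only [hF, hΦ, Function.comp_apply, Complex.add_im,
      Complex.im_ofReal_mul, Complex.log_im, harg, Complex.sub_im]
    ring
  have hsub : Ioo 0 (π / 2) ⊆ Ioo (-(π / 2)) (π / 2) := Ioo_subset_Ioo_left (by linarith)
  have hcont := continuousOn_Icc_extendFrom_Ioo (f := F)
    (fun v hv => (hFd v (hsub hv)).continuousAt.continuousWithinAt) hF0 hF1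
  have hint : IntervalIntegrable (cauerIntegrand (a * exp a)) MeasureTheory.volume 0 (π / 2) := by
    rw [intervalIntegrable_iff_integrableOn_Ioc_of_le hpos.le]
    refine intervalIntegral.integrableOn_deriv_of_nonneg hcont (fun v hv => ?_)
      (fun v hv => cauerIntegrand_nonneg _ hv)
    refine (hFd v (hsub hv)).congr_of_eventuallyEq ?_
    filter_upwards [isOpen_Ioo.mem_nhds hv] with t ht
    exact extendFrom_extends
      (fun s hs => (hFd s (hsub hs)).continuousAt.continuousWithinAt) t ht
  rw [intervalIntegral.integral_eq_sub_of_hasDerivAt_of_tendsto hpos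
    (fun v hv => hFd v (hsub hv)) hint hF0 hF1, sub_zero]

/-- Cauer/Poisson-type representation of `W(x)/x` on `(0, ∞)`. -/
theorem lambertW_div_self_cauer (W : ℝ → ℝ)
    (hW : ∀ x > 0, W x * Real.exp (W x) = x) (hWpos : ∀ x > 0, W x > 0) :
    ∀ x > (0:ℝ),
      W x / x = (2 / π) * ∫ v in (0:ℝ)..(π / 2),
        ((v ^ 2 + (1 + v * Real.tan v) ^ 2) * v * (1 / Real.cos v) *
            Real.exp (v * Real.tan v) * Real.tan v) /
          (x ^ 2 + v ^ 2 * (1 / Real.cos v) ^ 2 * Real.exp (2 * v * Real.tan v)) := by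
  intro x hx
  have h := integral_cauerIntegrand (hWpos x hx)
  rw [hW x hx] at h
  simp only [cauerIntegrand] at h
  rw [h]
  nth_rewrite 2 [← hW x hx]
  have := (hWpos x hx).ne'
  rw [exp_neg]
  field_simp
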